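/- Let p be a prime and q a power of p, let w1, w2 be positive integers with at least one of them greater than 1, and let 2 ≤ k ≤ q−1 with (k−1) dividing q. Suppose that (k−1)·w1·w2 ≥ p·q (i.e., k−1 ≥ pq/(w1·w2)). If the Reed–Solomon code RS_k(q) is (w1,w2)-separating, then k < (q−1)/(w1·w2) + 1, i.e., (k−1)·w1·w2 < q−1. -/

import Mathlib

open scoped Pointwise

/-- The descendant set of a set `U` of words: all words `x` such that each coordinate
of `x` agrees with some word of `U` there. -/
def descSet {Q : Type*} {n : ℕ} (U : Set (Fin n → Q)) : Set (Fin n → Q) :=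
  {x | ∀ i : Fin n, ∃ a ∈ U, a i = x i}

/-- A code `C` is `(w1, w2)`-separating if the descendant sets of any two disjoint
nonempty subsets of `C` of sizes at most `w1` and `w2` are disjoint. -/
def Separating {Q : Type*} {n : ℕ} (C : Set (Fin n → Q)) (w1 w2 : ℕ) : Prop :=
  ∀ U V : Finset (Fin n → Q), ↑U ⊆ C → ↑V ⊆ C → U.Nonempty → V.Nonempty →
    Disjoint U V → U.card ≤ w1 → V.card ≤ w2 →
      Disjoint (descSet (↑U : Set (Fin n → Q))) (descSet (↑V : Set (Fin n → Q)))

/-- The Reed–Solomon code of dimension `k` over the field `F` with primitive element `α`: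
the words `(f(α^1), …, f(α^n))` for polynomials `f` of degree less than `k`. -/
def RSCode (F : Type*) [Field F] (n : ℕ) (α : F) (k : ℕ) : Set (Fin n → F) :=
  {c | ∃ f : Polynomial F, f.degree < (k : ℕ) ∧
    ∀ i : Fin n, c i = Polynomial.eval (α ^ ((i : ℕ) + 1)) f}

open Polynomial in
/-- Over a field of characteristic `p` there are additive polynomials of degree `p ^ i` whose
kernel is as large as the degree allows. -/
theorem exists_polynomial_linearMap_natDegree_eq_pow (p : ℕ) [Fact p.Prime] {F : Type*} [Field F]
    [Finite F] [CharP F p] [Algebra (ZMod p) F] {i : ℕ} (hi : i ≤ Module.finrank (ZMod p) F) :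
    ∃ (f : F[X]) (T : F →ₗ[ZMod p] F), (∀ x, f.eval x = T x) ∧ f.natDegree = p ^ i ∧
      i ≤ Module.finrank (ZMod p) (LinearMap.ker T) := by
  have hp : p.Prime := Fact.out
  induction i with
  | zero => exact ⟨X, LinearMap.id, by simp, by simp, Nat.zero_le _⟩
  | succ i ih =>
    obtain ⟨f, T, hfT, hdeg, hker⟩ := ih (by omega)
    have natDegree_step (c : F) : (f ^ p - C c * f).natDegree = p ^ (i + 1) := by
      have hpow : (f ^ p).natDegree = p ^ (i + 1) := by
        rw [natDegree_pow, hdeg, pow_succ']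
      rw [natDegree_sub_eq_left_of_natDegree_lt, hpow]
      calc (C c * f).natDegree ≤ p ^ i := (natDegree_C_mul_le _ _).trans hdeg.le
        _ < p ^ (i + 1) := Nat.pow_lt_pow_right hp.one_lt (Nat.lt_succ_self i)
        _ = (f ^ p).natDegree := hpow.symm
    let step (c : F) : F →ₗ[ZMod p] F :=
      ((frobenius F p).toAddMonoidHom.comp T.toAddMonoidHom).toZModLinearMap p - c • T
    have step_apply (c x : F) : step c x = T x ^ p - c * T x := rfl
    obtain ⟨c, hc⟩ : ∃ c : F, i + 1 ≤ Module.finrank (ZMod p) (LinearMap.ker (step c)) := by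
      by_cases hT : ∃ v, T v ≠ 0
      · obtain ⟨v, hv⟩ := hT
        refine ⟨T v ^ (p - 1), hker.trans_lt (Submodule.finrank_lt_finrank_of_lt ?_)⟩
        refine SetLike.lt_iff_le_and_exists.2 ⟨fun x hx => ?_, v, ?_, by simpa using hv⟩
        · rw [LinearMap.mem_ker] at hx ⊢
          simp [step_apply, hx, hp.ne_zero]
        · rw [LinearMap.mem_ker, step_apply, pow_sub_one_mul hp.ne_zero, sub_self]
      · push Not at hT
        refine ⟨0, ?_⟩
        have hstep : step 0 = 0 := by
          ext x
          simp [step_apply, hT, hp.ne_zero]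
        rw [hstep, LinearMap.ker_zero, finrank_top]
        exact hi
    exact ⟨f ^ p - C c * f, step c, fun x => by simp [step_apply, hfT], natDegree_step c, hc⟩

/-- A finite `ZMod p`-module is a sumset `A + B` with prescribed bounds on the sizes of `A`
and `B`, provided their product exceeds the size of the module by a factor of `p`. -/
theorem exists_finset_add_cover (p : ℕ) [Fact p.Prime] (M : Type*) [AddCommGroup M]
    [Module (ZMod p) M] [Finite M] {w1 w2 : ℕ} (hw1 : 1 ≤ w1) (hw2 : 1 ≤ w2)
    (h : p ^ (Module.finrank (ZMod p) M + 1) ≤ w1 * w2) :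
    ∃ A B : Finset M, A.card ≤ w1 ∧ B.card ≤ w2 ∧ ∀ x, ∃ a ∈ A, ∃ b ∈ B, a + b = x := by
  classical
  have hp : p.Prime := Fact.out
  have := Fintype.ofFinite M
  set r := Module.finrank (ZMod p) M with hr
  obtain ⟨a, har, ha1, ha2⟩ : ∃ a ≤ r, p ^ a ≤ w1 ∧ p ^ (r - a) ≤ w2 := by
    rcases le_total r (Nat.log p w1) with hle | hle
    · exact ⟨r, le_rfl, Nat.pow_le_of_le_log (by omega) hle, by simpa using hw2⟩
    · refine ⟨Nat.log p w1, hle, Nat.pow_log_le_self p (by omega), ?_⟩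
      have hlt : w1 < p ^ (Nat.log p w1 + 1) := Nat.lt_pow_succ_log_self hp.one_lt w1
      have hsplit : p ^ (r + 1) = p ^ (Nat.log p w1 + 1) * p ^ (r - Nat.log p w1) := by
        rw [← pow_add]
        congr 1
        omega
      by_contra! hcon
      rw [hsplit] at h
      exact absurd h (Nat.mul_lt_mul'' hlt hcon).not_ge
  obtain ⟨s, hs, hli⟩ := exists_finset_linearIndependent_of_le_finrank (R := ZMod p) (M := M) har
  let A := Submodule.span (ZMod p) (s : Set M)
  have hA : Module.finrank (ZMod p) A = a := by
    rw [finrank_span_finset_eq_card hli, hs]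
  obtain ⟨B, hAB⟩ := A.exists_isCompl
  have hB : Module.finrank (ZMod p) B = r - a := by
    have := Submodule.finrank_add_eq_of_isCompl hAB
    omega
  have card_toFinset (N : Submodule (ZMod p) M) :
      (N : Set M).toFinset.card = p ^ Module.finrank (ZMod p) N := by
    have := Module.card_eq_pow_finrank (K := ZMod p) (V := N)
    rw [ZMod.card] at this
    rw [← this, Set.toFinset_card]
    rfl
  refine ⟨(A : Set M).toFinset, (B : Set M).toFinset, ?_, ?_, fun x => ?_⟩
  · rwa [card_toFinset, hA]
  · rwa [card_toFinset, hB]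
  · obtain ⟨y, hy, z, hz, hyz⟩ :=
      Submodule.mem_sup.1 (hAB.sup_eq_top ▸ Submodule.mem_top : x ∈ A ⊔ B)
    exact ⟨y, by simpa using hy, z, by simpa using hz, hyz⟩

/-- A nonconstant polynomial that takes the same value at `α, α ^ 2, …, α ^ (q - 1)` for a
primitive element `α` of a field with `q` elements has degree at least `q - 1`. -/
theorem le_natDegree_of_eval_pow_eq {F : Type*} [Field F] [Fintype F] {α : F} (hα0 : α ≠ 0)
    (hα : ∀ x : F, x ≠ 0 → ∃ j : ℕ, α ^ j = x) {f : Polynomial F} (hf : f.natDegree ≠ 0) {c : F}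
    (hc : ∀ i : Fin (Fintype.card F - 1), f.eval (α ^ ((i : ℕ) + 1)) = c) :
    Fintype.card F - 1 ≤ f.natDegree := by
  classical
  have hcard : 1 < Fintype.card F := Fintype.one_lt_card
  have hval (x : F) (hx : x ≠ 0) : f.eval x = c := by
    obtain ⟨y, hy⟩ := hα (x * α⁻¹) (mul_ne_zero hx (inv_ne_zero hα0))
    have hx' : α ^ (y % (Fintype.card F - 1) + 1) = x := by
      rw [pow_succ, ← pow_eq_pow_mod y (FiniteField.pow_card_sub_one_eq_one α hα0), hy,
        inv_mul_cancel_right₀ hα0]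
    exact hx' ▸ hc ⟨y % (Fintype.card F - 1), Nat.mod_lt _ (by omega)⟩
  by_contra! hlt
  have hzero : f - Polynomial.C c = 0 := by
    refine Polynomial.eq_zero_of_natDegree_lt_card_of_eval_eq_zero' _
      (Finset.univ.erase (0 : F)) (fun x hx => ?_) ?_
    · simp [hval x (Finset.ne_of_mem_erase hx)]
    · rw [Polynomial.natDegree_sub_C, Finset.card_erase_of_mem (Finset.mem_univ _),
        Finset.card_univ]
      exact hlt
  exact hf (by rw [sub_eq_zero.1 hzero, Polynomial.natDegree_C])

/-- Condition (1) of Theorem 5: if `k - 1` divides `q` and `(k-1)·w1·w2 ≥ p·q`, and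
`RS_k(q)` is `(w1, w2)`-separating, then `(k - 1) · w1 · w2 < q - 1`. -/
theorem RS_separating_dim_bound_cond1 {p m : ℕ} (hp : p.Prime)
    {F : Type*} [Field F] [Fintype F] {q : ℕ}
    (hq : Fintype.card F = q) (hpq : q = p ^ m)
    (α : F) (hα : ∀ x : F, x ≠ 0 → ∃ j : ℕ, α ^ j = x)
    {w1 w2 : ℕ} (hw1 : 1 ≤ w1) (hw2 : 1 ≤ w2) (hw : 1 < w1 ∨ 1 < w2)
    {k : ℕ} (hk2 : 2 ≤ k) (hkq : k ≤ q - 1) (hdvd : (k - 1) ∣ q)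
    (hcond : p * q ≤ (k - 1) * w1 * w2)
    (hsep : Separating (RSCode F (q - 1) α k) w1 w2) :
    (k - 1) * w1 * w2 < q - 1 := by
  classical
  exfalso
  have := Fact.mk hp
  have : CharP F p := charP_of_card_eq_prime_pow (hq.trans hpq)
  let _ : Algebra (ZMod p) F := ZMod.algebra F p
  have hfin : Module.finrank (ZMod p) F = m := by
    have h := Module.card_eq_pow_finrank (K := ZMod p) (V := F)
    rw [ZMod.card, hq, hpq] at h
    exact (Nat.pow_right_injective hp.two_le h).symm
  obtain ⟨e, hem, hke⟩ := (Nat.dvd_prime_pow hp).1 (hpq ▸ hdvd)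
  obtain ⟨f, T, hfT, hdeg, hker⟩ :=
    exists_polynomial_linearMap_natDegree_eq_pow p (F := F) (hem.trans_eq hfin.symm)
  have hrange : p ^ (Module.finrank (ZMod p) (LinearMap.range T) + 1) ≤ w1 * w2 := by
    have hrank := LinearMap.finrank_range_add_finrank_ker T
    have hsize : p ^ e * p ^ (m - e + 1) ≤ p ^ e * (w1 * w2) := by
      rw [hke, hpq, mul_assoc, ← pow_succ'] at hcond
      rwa [← pow_add, show e + (m - e + 1) = m + 1 by omega]
    exact (Nat.pow_le_pow_right hp.pos (by omega)).trans
      (Nat.le_of_mul_le_mul_left hsize (pow_pos hp.pos e))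
  obtain ⟨A, B, hA, hB, hAB⟩ := exists_finset_add_cover p (LinearMap.range T) hw1 hw2 hrange
  obtain ⟨a₀, ha₀, b₀, hb₀, -⟩ := hAB 0
  let u (a : LinearMap.range T) (i : Fin (q - 1)) : F := f.eval (α ^ ((i : ℕ) + 1)) - a
  let v (b : LinearMap.range T) (_ : Fin (q - 1)) : F := b
  have hu (a) : u a ∈ RSCode F (q - 1) α k := by
    refine ⟨f - Polynomial.C (a : F), ?_, fun i => by simp [u]⟩
    refine Polynomial.degree_le_natDegree.trans_lt ?_
    rw [Polynomial.natDegree_sub_C, hdeg, ← hke]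
    exact_mod_cast (by omega : k - 1 < k)
  have hv (b) : v b ∈ RSCode F (q - 1) α k :=
    ⟨Polynomial.C (b : F), Polynomial.degree_C_le.trans_lt (by exact_mod_cast (by omega : 0 < k)),
      fun i => by simp [v]⟩
  have hdisj : Disjoint (A.image u) (B.image v) := by
    rw [Finset.disjoint_left]
    intro x hx hx'
    obtain ⟨a, -, rfl⟩ := Finset.mem_image.1 hx
    obtain ⟨b, -, hb⟩ := Finset.mem_image.1 hx'
    have hq3 : 2 < Fintype.card F := by omega
    have hα0 : α ≠ 0 := by
      rintro rfl
      obtain ⟨x, -, hx⟩ := Finset.exists_mem_notMem_of_card_lt_card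
        (s := {(0 : F), 1}) (t := Finset.univ) (Finset.card_le_two.trans_lt hq3)
      simp only [Finset.mem_insert, Finset.mem_singleton, not_or] at hx
      obtain ⟨j, rfl⟩ := hα x hx.1
      rcases eq_or_ne j 0 with rfl | hj
      · exact hx.2 (pow_zero _)
      · exact hx.1 (zero_pow hj)
    subst hq
    have hle := le_natDegree_of_eval_pow_eq hα0 hα (f := f) (c := b + a)
      (by rw [hdeg, ← hke]; omega) (fun i => (sub_eq_iff_eq_add.1 (congrFun hb i).symm))
    rw [hdeg, ← hke] at hle
    omega
  have hsep' := hsep (A.image u) (B.image v)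
    (fun x hx => by
      obtain ⟨a, -, rfl⟩ := Finset.mem_image.1 (Finset.mem_coe.1 hx)
      exact hu a)
    (fun x hx => by
      obtain ⟨b, -, rfl⟩ := Finset.mem_image.1 (Finset.mem_coe.1 hx)
      exact hv b)
    (Finset.Nonempty.image ⟨a₀, ha₀⟩ u) (Finset.Nonempty.image ⟨b₀, hb₀⟩ v) hdisj
    (Finset.card_image_le.trans hA) (Finset.card_image_le.trans hB)
  choose a ha b hb hab using hAB
  let y (i : Fin (q - 1)) : LinearMap.range T :=
    ⟨T (α ^ ((i : ℕ) + 1)), LinearMap.mem_range_self _ _⟩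
  refine Set.disjoint_left.1 hsep' (show (fun i => (b (y i) : F)) ∈ _ from fun i => ?_)
    (fun i => ?_)
  · refine ⟨u (a (y i)), by exact_mod_cast Finset.mem_image_of_mem u (ha _), ?_⟩
    have h : (a (y i) : F) + b (y i) = T (α ^ ((i : ℕ) + 1)) := congrArg Subtype.val (hab (y i))
    simp [u, hfT, ← h]
  · exact ⟨v (b (y i)), by exact_mod_cast Finset.mem_image_of_mem v (hb _), rfl⟩
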